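/- For all real g and Δ, the linear operators H₁ and J₁ on ℝ[z] ⊕ ℝ[z] commute: H₁ ∘ J₁ = J₁ ∘ H₁. (The hidden symmetry of the asymmetric quantum Rabi model with bias ℓ = 1.) -/

import Mathlib

open Polynomial

/-- The parity operator `(𝒫 f)(z) = f(-z)` on real polynomials. -/
noncomputable def Par (f : Polynomial ℝ) : Polynomial ℝ := f.comp (-Polynomial.X)

/-- Bargmann realization of `H̃₁ = a†a + Δσₓ + g(a+a†)σ_z + (1/2)σ_z`
on `ℝ[z] ⊕ ℝ[z]`. -/
noncomputable def H1 (g Δ : ℝ) (F : Polynomial ℝ × Polynomial ℝ) :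
    Polynomial ℝ × Polynomial ℝ :=
  (Polynomial.X * derivative F.1 + C g * (Polynomial.X * F.1 + derivative F.1)
      + C (1 / 2) * F.1 + C Δ * F.2,
   C Δ * F.1 + Polynomial.X * derivative F.2 - C g * (Polynomial.X * F.2 + derivative F.2)
      - C (1 / 2) * F.2)

/-- The hidden symmetry operator `J₁ = 𝒫 [[Δ, 2g(g−∂)],[2g(g+z), Δ]]`
on `ℝ[z] ⊕ ℝ[z]`. -/
noncomputable def J1 (g Δ : ℝ) (F : Polynomial ℝ × Polynomial ℝ) :
    Polynomial ℝ × Polynomial ℝ :=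
  (Par (C Δ * F.1 + C (2 * g) * (C g * F.2 - derivative F.2)),
   Par (C (2 * g) * ((C g + Polynomial.X) * F.1) + C Δ * F.2))

theorem derivative_Par (f : Polynomial ℝ) : derivative (Par f) = -Par (derivative f) := by
  simp [Par, derivative_comp]

theorem C_half_mul_two : (C (1 / 2) : Polynomial ℝ) * 2 = 1 := by
  rw [← C_ofNat, ← C_mul]; norm_num

theorem H1_J1_apply_fst (g Δ : ℝ) (F : Polynomial ℝ × Polynomial ℝ) :
    (H1 g Δ (J1 g Δ F)).1 = (J1 g Δ (H1 g Δ F)).1 := by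
  simp only [H1, J1, derivative_Par]
  simp only [Par, derivative_add, derivative_sub, derivative_mul, derivative_C, derivative_X,
    add_comp, sub_comp, mul_comp, C_comp, X_comp, C_mul, zero_mul, zero_add, one_mul, C_ofNat,
    zero_comp, ofNat_comp, derivative_ofNat]
  linear_combination C g * (C g * F.2.comp (-X) - (derivative F.2).comp (-X)) * 2 * C_half_mul_two

theorem H1_J1_apply_snd (g Δ : ℝ) (F : Polynomial ℝ × Polynomial ℝ) :
    (H1 g Δ (J1 g Δ F)).2 = (J1 g Δ (H1 g Δ F)).2 := by
  simp only [H1, J1, derivative_Par]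
  simp only [Par, derivative_add, derivative_mul, derivative_C, derivative_X,
    add_comp, sub_comp, mul_comp, C_comp, X_comp, C_mul, zero_mul, zero_add, one_mul, C_ofNat,
    zero_comp, ofNat_comp, derivative_ofNat]
  linear_combination (-2) * C g * (C g - X) * F.1.comp (-X) * C_half_mul_two

/-- The hidden symmetry of the asymmetric quantum Rabi model with bias `ℓ = 1`:
`H₁` and `J₁` commute. -/
theorem stmt4 (g Δ : ℝ) : H1 g Δ ∘ J1 g Δ = J1 g Δ ∘ H1 g Δ := by
  funext F
  exact Prod.ext (H1_J1_apply_fst g Δ F) (H1_J1_apply_snd g Δ F)
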